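/- For every n ≥ 3, the Fibonacci word w_n with its last two letters removed is a palindrome. -/

import Mathlib

/-- The `n`-th Fibonacci word over the alphabet `Bool` (`true` = A, `false` = B). -/
def fibWord : ℕ → List Bool
  | 0 => []
  | 1 => [true]
  | 2 => [true, false]
  | (n + 3) => fibWord (n + 2) ++ fibWord (n + 1)

theorem fibWord_invariant (n : ℕ) : ∃ (p q : List Bool) (a b : Bool),
    fibWord (n + 2) = p ++ [a, b] ∧ fibWord (n + 3) = q ++ [b, a] ∧
    p.reverse = p ∧ q.reverse = q ∧ q ++ [b, a] ++ p = p ++ [a, b] ++ q := by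
  induction n with
  | zero => exact ⟨[], [true], true, false, by simp [fibWord]⟩
  | succ n ih =>
    obtain ⟨p, q, a, b, h1, h2, hp, hq, h⟩ := ih
    refine ⟨q, q ++ [b, a] ++ p, b, a, h2, ?_, hq, ?_, ?_⟩
    · rw [show n + 1 + 3 = (n + 1) + 3 from rfl, fibWord,
        show n + 1 + 2 = n + 3 from rfl, show n + 1 + 1 = n + 2 from rfl, h2, h1]
      simp
    · rw [h]
      simp only [List.reverse_append, hp, hq]
      simpa using h
    · conv_rhs => rw [h]
      simp

theorem fibWord_dropLast_two_palindrome (n : ℕ) (hn : 3 ≤ n) :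
    ((fibWord n).take ((fibWord n).length - 2)).reverse
      = (fibWord n).take ((fibWord n).length - 2) := by
  obtain ⟨m, rfl⟩ := Nat.exists_eq_add_of_le' hn
  obtain ⟨p, q, a, b, -, h2, -, hq, -⟩ := fibWord_invariant m
  rw [h2]
  simp [hq]
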